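/- arXiv:2007.00596 — 3 statements merged into one kernel-verified Lean document; each statement's English description precedes it below -/
import Mathlib

section
/- Let X ∈ ℝ^{n×p} and let S ⊆ V(n,k) × V(p,k) be an arbitrary nonempty set of pairs (Z,Y). A pair (Z*, Y*) ∈ S satisfies ‖Z*ᵀ X Y*‖_F ≥ ‖Zᵀ X Y‖_F for all (Z,Y) ∈ S if and only if, setting B* = Z*ᵀ X Y*, the triple (Z*, B*, Y*) satisfies ‖X − Z* B* Y*ᵀ‖_F ≤ ‖X − Z B Yᵀ‖_F for all (Z,Y) ∈ S and all B ∈ ℝ^{k×k}. (Maximizing ‖Zᵀ X Y‖_F over the constraint set is equivalent to minimizing the reconstruction error ‖X − Z B Yᵀ‖_F over the same constraint set together with arbitrary B.) -/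
open Matrix BigOperators

/-- Squared Frobenius norm of a real matrix. -/
noncomputable def frobSq {m n : ℕ} (A : Matrix (Fin m) (Fin n) ℝ) : ℝ :=
  ∑ i, ∑ j, (A i j) ^ 2

/-- Frobenius norm of a real matrix. -/
noncomputable def frobNorm {m n : ℕ} (A : Matrix (Fin m) (Fin n) ℝ) : ℝ :=
  Real.sqrt (frobSq A)

theorem frobSq_nonneg {m n : ℕ} (A : Matrix (Fin m) (Fin n) ℝ) : 0 ≤ frobSq A :=
  Finset.sum_nonneg fun _ _ => Finset.sum_nonneg fun _ _ => sq_nonneg _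

theorem frobSq_zero {m n : ℕ} : frobSq (0 : Matrix (Fin m) (Fin n) ℝ) = 0 := by
  simp [frobSq]

theorem frobSq_eq_trace {m n : ℕ} (A : Matrix (Fin m) (Fin n) ℝ) :
    frobSq A = (Aᵀ * A).trace := by
  simp only [frobSq, Matrix.trace, Matrix.diag_apply, Matrix.mul_apply, Matrix.transpose_apply, sq]
  exact Finset.sum_comm

theorem frobNorm_le_frobNorm_iff {m n m' n' : ℕ} (A : Matrix (Fin m) (Fin n) ℝ)
    (B : Matrix (Fin m') (Fin n') ℝ) : frobNorm A ≤ frobNorm B ↔ frobSq A ≤ frobSq B :=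
  Real.sqrt_le_sqrt_iff (frobSq_nonneg B)

/-- Pythagorean decomposition of the reconstruction error. -/
theorem frobSq_sub_mul_mul_transpose {n p k l : ℕ} (X : Matrix (Fin n) (Fin p) ℝ)
    {Z : Matrix (Fin n) (Fin k) ℝ} {Y : Matrix (Fin p) (Fin l) ℝ}
    (hZ : Zᵀ * Z = 1) (hY : Yᵀ * Y = 1) (B : Matrix (Fin k) (Fin l) ℝ) :
    frobSq (X - Z * B * Yᵀ) =
      frobSq X - frobSq (Zᵀ * X * Y) + frobSq (Zᵀ * X * Y - B) := by
  have h₁ : (Xᵀ * (Z * B * Yᵀ)).trace = ((Zᵀ * X * Y)ᵀ * B).trace := by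
    rw [← Matrix.mul_assoc, Matrix.trace_mul_comm]
    simp only [Matrix.transpose_mul, Matrix.transpose_transpose, Matrix.mul_assoc]
  have h₂ : ((Z * B * Yᵀ)ᵀ * X).trace = (Bᵀ * (Zᵀ * X * Y)).trace := by
    simp only [Matrix.transpose_mul, Matrix.transpose_transpose, Matrix.mul_assoc]
    rw [Matrix.trace_mul_comm]
    simp only [Matrix.mul_assoc]
  have h₃ : ((Z * B * Yᵀ)ᵀ * (Z * B * Yᵀ)).trace = (Bᵀ * B).trace := by
    have h : (Z * B * Yᵀ)ᵀ * (Z * B * Yᵀ) = Y * (Bᵀ * (Zᵀ * Z) * B * Yᵀ) := by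
      simp only [Matrix.transpose_mul, Matrix.transpose_transpose, Matrix.mul_assoc]
    rw [h, Matrix.trace_mul_comm, Matrix.mul_assoc, hY, hZ, Matrix.mul_one, Matrix.mul_one]
  simp only [frobSq_eq_trace, Matrix.transpose_sub, Matrix.sub_mul, Matrix.mul_sub,
    Matrix.trace_sub, h₁, h₂, h₃]
  ring

/-- Over any set `S` of Stiefel pairs `(Z, Y)`, the pair `(Z*, Y*)` maximizes
`‖Zᵀ X Y‖_F` iff, with `B* = Z*ᵀ X Y*`, the triple `(Z*, B*, Y*)` minimizes the
reconstruction error `‖X − Z B Yᵀ‖_F` over `(Z,Y) ∈ S` and arbitrary `B`. -/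
theorem stmt4 {n p k : ℕ} (X : Matrix (Fin n) (Fin p) ℝ)
    (S : Set (Matrix (Fin n) (Fin k) ℝ × Matrix (Fin p) (Fin k) ℝ))
    (hS : ∀ q ∈ S, q.1ᵀ * q.1 = 1 ∧ q.2ᵀ * q.2 = 1)
    (hSne : S.Nonempty)
    (Zs : Matrix (Fin n) (Fin k) ℝ) (Ys : Matrix (Fin p) (Fin k) ℝ)
    (hmem : (Zs, Ys) ∈ S) :
    (∀ q ∈ S, frobNorm (q.1ᵀ * X * q.2) ≤ frobNorm (Zsᵀ * X * Ys)) ↔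
    (∀ q ∈ S, ∀ B : Matrix (Fin k) (Fin k) ℝ,
        frobNorm (X - Zs * (Zsᵀ * X * Ys) * Ysᵀ) ≤ frobNorm (X - q.1 * B * q.2ᵀ)) := by
  obtain ⟨hZs, hYs⟩ := hS _ hmem
  simp only [frobNorm_le_frobNorm_iff]
  have hopt := frobSq_sub_mul_mul_transpose X hZs hYs (Zsᵀ * X * Ys)
  rw [sub_self, frobSq_zero] at hopt
  constructor
  · intro h q hq B
    have herr := frobSq_sub_mul_mul_transpose X (hS q hq).1 (hS q hq).2 B
    linarith [h q hq, frobSq_nonneg (q.1ᵀ * X * q.2 - B)]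
  · intro h q hq
    have herr := frobSq_sub_mul_mul_transpose X (hS q hq).1 (hS q hq).2 (q.1ᵀ * X * q.2)
    rw [sub_self, frobSq_zero] at herr
    linarith [h q hq (q.1ᵀ * X * q.2)]
end

section
/- Let y_1, y_2 ∈ ℝ^p be orthogonal unit vectors (⟨y_1, y_2⟩ = 0, ‖y_1‖₂ = ‖y_2‖₂ = 1) and let ŷ_1, ŷ_2 ∈ ℝ^p be nonzero vectors. Let θ_i ∈ [0,π] be the angle between ŷ_i and y_i for i = 1,2. If θ_1 + θ_2 ≤ π/2, then |⟨ŷ_1, ŷ_2⟩| ≤ sin(θ_1 + θ_2) · ‖ŷ_1‖₂ · ‖ŷ_2‖₂. -/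
open scoped RealInnerProductSpace

open InnerProductGeometry in
/-- If `x` and `y` are orthogonal, the angle between `u` and `v` is at least the right angle
minus the deviations of `u` from `x` and of `v` from `y`. -/
theorem pi_div_two_sub_le_angle {V : Type*} [NormedAddCommGroup V] [InnerProductSpace ℝ V]
    {x y : V} (hxy : ⟪x, y⟫ = 0) (u v : V) :
    Real.pi / 2 - (angle u x + angle v y) ≤ angle u v := by
  have hangle := inner_eq_zero_iff_angle_eq_pi_div_two x y |>.mp hxy
  have hx := angle_le_angle_add_angle x u y
  have hy := angle_le_angle_add_angle u v y
  rw [angle_comm x u] at hx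
  linarith

/-- For orthogonal unit vectors `y₁, y₂` and nonzero `ŷ₁, ŷ₂` with angles
`θ_i` between `ŷ_i` and `y_i`, if `θ₁ + θ₂ ≤ π/2` then
`|⟨ŷ₁, ŷ₂⟩| ≤ sin(θ₁ + θ₂)·‖ŷ₁‖₂·‖ŷ₂‖₂`. -/
theorem stmt11 {p : ℕ} (y₁ y₂ : EuclideanSpace ℝ (Fin p))
    (hy₁ : ‖y₁‖ = 1) (hy₂ : ‖y₂‖ = 1) (horth : ⟪y₁, y₂⟫ = 0)
    (yhat₁ yhat₂ : EuclideanSpace ℝ (Fin p))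
    (h₁ : yhat₁ ≠ 0) (h₂ : yhat₂ ≠ 0)
    (hsum : InnerProductGeometry.angle yhat₁ y₁ + InnerProductGeometry.angle yhat₂ y₂
        ≤ Real.pi / 2) :
    |⟪yhat₁, yhat₂⟫|
      ≤ Real.sin (InnerProductGeometry.angle yhat₁ y₁ +
            InnerProductGeometry.angle yhat₂ y₂) * ‖yhat₁‖ * ‖yhat₂‖ := by
  have hlower := pi_div_two_sub_le_angle horth yhat₁ yhat₂
  have hupper := pi_div_two_sub_le_angle (y := -y₂) (by simpa using horth) yhat₁ (-yhat₂)
  rw [InnerProductGeometry.angle_neg_neg, InnerProductGeometry.angle_neg_right] at hupper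
  set s := InnerProductGeometry.angle yhat₁ y₁ + InnerProductGeometry.angle yhat₂ y₂
  have hcos_le : Real.cos (InnerProductGeometry.angle yhat₁ yhat₂) ≤ Real.sin s := by
    rw [← Real.cos_pi_div_two_sub]
    exact Real.cos_le_cos_of_nonneg_of_le_pi (by linarith)
      (InnerProductGeometry.angle_le_pi _ _) hlower
  have hneg_cos_le : -Real.cos (InnerProductGeometry.angle yhat₁ yhat₂) ≤ Real.sin s := by
    rw [← Real.cos_pi_div_two_sub, ← Real.cos_pi_sub]
    exact Real.cos_le_cos_of_nonneg_of_le_pi (by linarith)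
      (by linarith [InnerProductGeometry.angle_nonneg yhat₁ yhat₂]) hupper
  rw [← InnerProductGeometry.cos_angle_mul_norm_mul_norm, abs_mul,
    abs_of_nonneg (by positivity : 0 ≤ ‖yhat₁‖ * ‖yhat₂‖), mul_assoc]
  exact mul_le_mul_of_nonneg_right (abs_le'.mpr ⟨hcos_le, hneg_cos_le⟩) (by positivity)
end

section
/- Let Y ∈ ℝ^{p×k}, t ≥ 0, and let Ŷ = T_t(Y) be the entrywise soft-thresholding of Y. Suppose ‖Ŷ‖₁ = γ for some γ ≥ 0. Then for every W ∈ ℝ^{p×k} with ‖W‖₁ ≤ γ, one has ‖Ŷ − Y‖_F ≤ ‖W − Y‖_F; that is, subject to the constraint ‖W‖₁ ≤ γ, soft-thresholding minimizes the Frobenius distance to Y. -/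
open Matrix BigOperators

/-- The soft-thresholding of `y` at level `t` minimizes `w ↦ (w - y) ^ 2 + 2 * t * |w|`. -/
theorem softThreshold_penalized_le {t : ℝ} (ht : 0 ≤ t) (y w : ℝ) :
    (Real.sign y * max (|y| - t) 0 - y) ^ 2 + 2 * t * |Real.sign y * max (|y| - t) 0| ≤
      (w - y) ^ 2 + 2 * t * |w| := by
  rcases le_total |y| t with h | h
  · rw [max_eq_right (sub_nonpos.2 h)]
    have hwy : w * y ≤ |w| * t :=
      calc w * y ≤ |w * y| := le_abs_self _
        _ = |w| * |y| := abs_mul w y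
        _ ≤ |w| * t := by gcongr
    simp only [mul_zero, abs_zero]
    nlinarith [sq_nonneg w]
  · rw [max_eq_left (sub_nonneg.2 h)]
    have hle := mul_le_mul_of_nonneg_left (le_abs_self w) ht
    have hneg := mul_le_mul_of_nonneg_left (neg_le_abs w) ht
    rcases lt_trichotomy y 0 with hy | rfl | hy
    · rw [Real.sign_of_neg hy, neg_one_mul, abs_neg, abs_of_nonneg (sub_nonneg.2 h),
        abs_of_neg hy]
      nlinarith [sq_nonneg (w - y - t)]
    · simp only [Real.sign_zero, zero_mul, abs_zero, sub_zero]
      nlinarith [sq_nonneg w, mul_nonneg ht (abs_nonneg w)]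
    · rw [Real.sign_of_pos hy, one_mul, abs_of_nonneg (sub_nonneg.2 h), abs_of_pos hy]
      nlinarith [sq_nonneg (w - y + t)]

/-- If `Ŷ = T_t(Y)` is the entrywise soft-thresholding of `Y` and `‖Ŷ‖₁ = γ`,
then `Ŷ` minimizes the Frobenius distance to `Y` among all matrices `W` with
`‖W‖₁ ≤ γ`. -/
theorem stmt18 {p k : ℕ} (Y : Matrix (Fin p) (Fin k) ℝ) (t : ℝ) (ht : 0 ≤ t)
    (Yhat : Matrix (Fin p) (Fin k) ℝ)
    (hYhat : ∀ i j, Yhat i j = Real.sign (Y i j) * max (|Y i j| - t) 0)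
    (γ : ℝ) (hγ : 0 ≤ γ) (hnorm : ∑ i, ∑ j, |Yhat i j| = γ) :
    ∀ W : Matrix (Fin p) (Fin k) ℝ, (∑ i, ∑ j, |W i j|) ≤ γ →
      frobNorm (Yhat - Y) ≤ frobNorm (W - Y) := by
  intro W hW
  refine Real.sqrt_le_sqrt ?_
  have key : ∑ i, ∑ j, ((Yhat i j - Y i j) ^ 2 + 2 * t * |Yhat i j|) ≤
      ∑ i, ∑ j, ((W i j - Y i j) ^ 2 + 2 * t * |W i j|) := by
    refine Finset.sum_le_sum fun i _ => Finset.sum_le_sum fun j _ => ?_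
    rw [hYhat]
    exact softThreshold_penalized_le ht (Y i j) (W i j)
  simp only [Finset.sum_add_distrib, ← Finset.mul_sum, hnorm] at key
  have hpen := mul_le_mul_of_nonneg_left hW (mul_nonneg zero_le_two ht)
  simp only [frobSq, Matrix.sub_apply]
  linarith
end
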